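/- Let T be a consistent theory in a first-order language τ. Then every model M of T_∀ embeds into a τ-structure N which is T-existentially closed; that is, there exist a τ-structure N and an embedding of M into N such that N is T-existentially closed. -/

import Mathlib

namespace ModelCompanionship

open FirstOrder Language

universe u v

variable {L : FirstOrder.Language.{u, v}}

/-- A bundled `L`-structure with carrier in `Type (max u v)`. -/
structure BStruc (L : FirstOrder.Language.{u, v}) where
  /-- the underlying set of the structure -/
  carrier : Type (max u v)
  /-- the interpretation of the symbols of `L` -/
  struc : L.Structure carrier

attribute [instance] BStruc.struc

/-- Iterated existential quantification of the last `k` bound variables. -/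
def exsN {α : Type*} : ∀ {m k : ℕ}, L.BoundedFormula α (m + k) → L.BoundedFormula α m
  | _, 0, φ => φ
  | _, _ + 1, φ => exsN φ.ex

/-- `ψ` is a universal (`Π₁`) sentence: `∀ x⃗, φ` with `φ` quantifier-free. -/
def IsUniversalSentence (ψ : L.Sentence) : Prop :=
  ∃ (n : ℕ) (φ : L.BoundedFormula Empty n), φ.IsQF ∧ ψ = φ.alls

/-- `ψ` is a `Π₂` sentence: `∀ x⃗, ∃ y⃗, φ` with `φ` quantifier-free. -/
def IsPi2Sentence (ψ : L.Sentence) : Prop :=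
  ∃ (m k : ℕ) (φ : L.BoundedFormula Empty (m + k)), φ.IsQF ∧ ψ = (exsN φ).alls

/-- `ψ` holds in every model of `T`. -/
def SemConseq (T : L.Theory) (ψ : L.Sentence) : Prop :=
  ∀ M : BStruc L, M.carrier ⊨ T → M.carrier ⊨ ψ

/-- `T` is consistent: it has a model. -/
def Consistent (T : L.Theory) : Prop :=
  ∃ M : BStruc L, M.carrier ⊨ T

/-- `T` is complete: it is consistent and decides every sentence. -/
def IsCompleteTheory (T : L.Theory) : Prop :=
  Consistent T ∧ ∀ ψ : L.Sentence, SemConseq T ψ ∨ SemConseq T ψ.not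

/-- `T_∀`: the set of universal sentences true in every model of `T`. -/
def univFrag (T : L.Theory) : L.Theory :=
  {ψ | IsUniversalSentence ψ ∧ SemConseq T ψ}

/-- Two formulas in the same free variables are `T`-equivalent. -/
def TEquiv (T : L.Theory) {n : ℕ} (φ ψ : L.Formula (Fin n)) : Prop :=
  ∀ M : BStruc L, M.carrier ⊨ T → ∀ v : Fin n → M.carrier, φ.Realize v ↔ ψ.Realize v

section Maps

variable {M : Type (max u v)} {N : Type (max u v)} [L.Structure M] [L.Structure N]

/-- `f` preserves and reflects all first-order formulas (with parameters). -/
def ElementaryOn (f : M → N) : Prop :=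
  ∀ (n : ℕ) (φ : L.Formula (Fin n)) (v : Fin n → M),
    φ.Realize v ↔ φ.Realize fun i => f (v i)

/-- The embedding `e` is `Σ₁`-elementary: every existential formula with parameters
from the domain which holds in the codomain holds in the domain. -/
def Sigma1Elementary (e : M ↪[L] N) : Prop :=
  ∀ (n k : ℕ) (φ : L.BoundedFormula (Fin n) k), φ.IsQF → ∀ v : Fin n → M,
    (φ.exs.Realize fun i => e (v i)) → φ.exs.Realize v

end Maps

/-- `M` is a `T`-existentially closed structure. -/
def IsEC (T : L.Theory) (M : Type (max u v)) [L.Structure M] : Prop :=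
  (∃ (N : BStruc L) (_ : M ↪[L] N.carrier), N.carrier ⊨ T) ∧
    ∀ (N : BStruc L) (e : M ↪[L] N.carrier), N.carrier ⊨ T → Sigma1Elementary e

/-- `T` is model complete: substructure inclusions between models of `T` are elementary. -/
def IsModelComplete (T : L.Theory) : Prop :=
  ∀ (M N : BStruc L) (e : M.carrier ↪[L] N.carrier),
    M.carrier ⊨ T → N.carrier ⊨ T → ElementaryOn (L := L) fun a => e a

/-- `T*` is a model companion of `T`. -/
def IsModelCompanion (T Tstar : L.Theory) : Prop :=
  (∀ M : BStruc L, M.carrier ⊨ T →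
      ∃ (N : BStruc L) (_ : M.carrier ↪[L] N.carrier), N.carrier ⊨ Tstar) ∧
    (∀ M : BStruc L, M.carrier ⊨ Tstar →
      ∃ (N : BStruc L) (_ : M.carrier ↪[L] N.carrier), N.carrier ⊨ T) ∧
    IsModelComplete Tstar


/-- `Γ` is realized, together with `T`, in some nonempty structure. -/
def SatN (T : L.Theory) {α : Type (max u v)} (Γ : Set (L.Formula α)) : Prop :=
  ∃ (N : BStruc L) (w : α → N.carrier), Nonempty N.carrier ∧ N.carrier ⊨ T ∧
    ∀ φ ∈ Γ, φ.Realize w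

theorem SatN.mono {T : L.Theory} {α : Type (max u v)} {Γ Δ : Set (L.Formula α)}
    (h : SatN T Δ) (hs : Γ ⊆ Δ) : SatN T Γ := by
  obtain ⟨N, w, h1, h2, h3⟩ := h
  exact ⟨N, w, h1, h2, fun φ hφ => h3 φ (hs hφ)⟩

theorem satN_compact (T : L.Theory) {α : Type (max u v)} (Γ : Set (L.Formula α))
    (h : ∀ Δ ⊆ Γ, Δ.Finite → SatN T Δ) : SatN T Γ := by
  classical
  have key : (((L.lhomWithConstants α).onTheory T) ∪
      (Formula.equivSentence '' Γ) : L[[α]].Theory).IsSatisfiable := by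
    rw [Theory.isSatisfiable_iff_isFinitelySatisfiable]
    intro T0 hT0
    obtain ⟨N, w, hne, hNT, hw⟩ := h (Γ ∩ Formula.equivSentence ⁻¹' (T0 : Set (L[[α]].Sentence)))
      Set.inter_subset_left
      (Set.Finite.inter_of_right (T0.finite_toSet.preimage
        (Formula.equivSentence.injective.injOn)) _)
    let : (constantsOn α).Structure N.carrier := constantsOn.structure w
    have : N.carrier ⊨ (T0 : L[[α]].Theory) := by
      rw [Theory.model_iff]
      intro ψ hψ
      rcases hT0 hψ with h1 | ⟨φ, hφ, rfl⟩
      · have : N.carrier ⊨ (L.lhomWithConstants α).onTheory T :=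
          (LHom.onTheory_model _ _).2 hNT
        exact Theory.realize_sentence_of_mem _ h1
      · exact (Formula.realize_equivSentence _ _).2 (hw φ ⟨hφ, hψ⟩)
    exact Theory.Model.isSatisfiable N.carrier
  obtain ⟨N⟩ := key
  let := (L.lhomWithConstants α).reduct N
  have hm := N.is_model
  refine ⟨⟨N, inferInstance⟩, fun a => (L.con a : N), inferInstance, ?_, ?_⟩
  · exact (LHom.onTheory_model (L.lhomWithConstants α) T).1 (hm.mono Set.subset_union_left)
  · intro φ hφ
    exact (Formula.realize_equivSentence _ _).1
      (Theory.realize_sentence_of_mem ((L.lhomWithConstants α).onTheory T ∪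
        (Formula.equivSentence '' Γ)) (Set.mem_union_right _ ⟨φ, hφ, rfl⟩))

/-- Quantifier-free diagram. -/
def qfDiag (L : FirstOrder.Language.{u, v}) (M : Type (max u v)) [L.Structure M] :
    Set (L.Formula M) :=
  {φ | φ.IsQF ∧ φ.Realize (id : M → M)}

theorem exists_conj {α : Type (max u v)} (Δ : Set (L.Formula α)) (hf : Δ.Finite)
    (hq : ∀ φ ∈ Δ, φ.IsQF) : ∃ θ : L.Formula α, θ.IsQF ∧
      ∀ (N : BStruc L) (w : α → N.carrier), θ.Realize w ↔ ∀ φ ∈ Δ, φ.Realize w := by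
  induction Δ, hf using Set.Finite.induction_on with
  | empty => exact ⟨⊤, BoundedFormula.IsQF.top, by simp⟩
  | insert _ _ ih =>
    obtain ⟨θ, h1, h2⟩ := ih fun φ hφ => hq φ (Set.mem_insert_of_mem _ hφ)
    rename_i a s _ _
    refine ⟨a ⊓ θ, (hq a (Set.mem_insert _ _)).inf h1, fun N w => ?_⟩
    rw [Formula.realize_inf, h2]
    simp

theorem realize_congr_free {α : Type (max u v)} [DecidableEq α] {M : Type*} [L.Structure M]
    (φ : L.Formula α) (v w : α → M)
    (h : ∀ a ∈ BoundedFormula.freeVarFinset φ, v a = w a) : φ.Realize v ↔ φ.Realize w := by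
  have h1 := BoundedFormula.realize_restrictFreeVar (φ := φ) (f := id) (v := fun a => v a)
    (xs := default) v (fun _ => rfl)
  have h2 := BoundedFormula.realize_restrictFreeVar (φ := φ) (f := id) (v := fun a => v a)
    (xs := default) w (fun a => h a a.2)
  exact h1.symm.trans h2

theorem exists_retract {M : Type*} [DecidableEq M] (s : Finset M) :
    ∃ (n : ℕ) (g : M → Fin n) (xs : Fin n → M), ∀ a ∈ s, xs (g a) = a := by
  rcases isEmpty_or_nonempty M with hM | ⟨⟨m⟩⟩
  · exact ⟨0, isEmptyElim, Fin.elim0, fun a => isEmptyElim a⟩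
  · let t := insert m s
    refine ⟨t.card, fun a => if h : a ∈ t then t.equivFin ⟨a, h⟩ else
      t.equivFin ⟨m, Finset.mem_insert_self _ _⟩, fun i => (t.equivFin.symm i : M), fun a ha => ?_⟩
    have : a ∈ t := Finset.mem_insert_of_mem ha
    simp [this]

theorem finite_diag (T : L.Theory) (M : Type (max u v)) [L.Structure M]
    (hM : M ⊨ univFrag T) (Δ : Set (L.Formula M)) (hf : Δ.Finite) (hs : Δ ⊆ qfDiag L M) :
    ∃ (N : BStruc L) (w : M → N.carrier), N.carrier ⊨ T ∧ ∀ φ ∈ Δ, φ.Realize w := by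
  classical
  obtain ⟨θ, hq, hθ⟩ := exists_conj Δ hf fun φ hφ => (hs hφ).1
  obtain ⟨n, g, xs, hg⟩ := exists_retract (BoundedFormula.freeVarFinset θ)
  have hMθ : θ.Realize (id : M → M) := (hθ ⟨M, inferInstance⟩ id).2 fun φ hφ => (hs hφ).2
  let χ : L.BoundedFormula Empty (n + 0) := BoundedFormula.relabel (fun a => Sum.inr (g a)) θ
  have hχ : ∀ (N : BStruc L) (ys : Fin n → N.carrier),
      χ.Realize default ys ↔ θ.Realize fun a => ys (g a) := by
    intro N ys
    simp only [χ, BoundedFormula.realize_relabel, Formula.Realize]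
    apply iff_of_eq
    congr 1
    exact Subsingleton.elim _ _
  by_contra hcon
  push Not at hcon
  have hmem : (χ.not).alls ∈ univFrag T := by
    refine ⟨⟨_, _, (hq.relabel _).not, rfl⟩, fun N hN => ?_⟩
    simp only [Sentence.Realize, BoundedFormula.realize_alls,
      BoundedFormula.realize_not]
    intro ys hys
    have h1 := (hχ N ys).1 hys
    obtain ⟨φ, hφ, h2⟩ := hcon N _ hN
    exact h2 ((hθ N _).1 h1 φ hφ)
  have h3 : M ⊨ (χ.not).alls := Theory.realize_sentence_of_mem _ hmem
  simp only [Sentence.Realize, BoundedFormula.realize_alls,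
    BoundedFormula.realize_not] at h3
  refine h3 xs ((hχ ⟨M, inferInstance⟩ xs).2 ?_)
  exact (realize_congr_free θ _ _ fun a ha => hg a ha).2 hMθ

/-- A valuation realizing the quantifier-free diagram is an embedding. -/
theorem exists_embedding {M N : Type (max u v)} [L.Structure M] [L.Structure N] (w : M → N)
    (hw : ∀ φ ∈ qfDiag L M, φ.Realize w) : ∃ e : M ↪[L] N, ∀ a, e a = w a := by
  have hiff : ∀ φ : L.Formula M, φ.IsQF → (φ.Realize w ↔ φ.Realize (id : M → M)) := by
    intro φ hφ
    refine ⟨fun h => ?_, fun h => hw φ ⟨hφ, h⟩⟩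
    by_contra h'
    exact (Formula.realize_not.1 (hw φ.not ⟨hφ.not, Formula.realize_not.2 h'⟩)) h
  refine ⟨⟨⟨w, fun a b hab => ?_⟩, fun {n} f x => ?_, fun {n} R x => ?_⟩, fun a => rfl⟩
  · have := (hiff ((Term.var a).equal (Term.var b))
      (BoundedFormula.IsAtomic.equal _ _).isQF).1 (by simpa using hab)
    simpa using this
  · have := (hiff (Term.equal (Term.var (Structure.funMap f x)) (Term.func f fun i => Term.var (x i)))
      (BoundedFormula.IsAtomic.equal _ _).isQF).2 (by simp)
    simpa [Function.comp_def] using this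
  · have := (hiff (R.formula fun i => Term.var (x i)) (BoundedFormula.IsAtomic.rel _ _).isQF)
    simpa [Formula.realize_rel, Function.comp_def] using this

theorem qf_formula_embedding {α : Type*} {M N : Type (max u v)} [L.Structure M] [L.Structure N]
    (e : M ↪[L] N) (φ : L.Formula α) (hφ : φ.IsQF) (v : α → M) :
    φ.Realize (fun a => e (v a)) ↔ φ.Realize v := by
  have := hφ.realize_embedding e (v := v) (xs := default)
  rw [Subsingleton.elim (e ∘ default) default] at this
  exact this

theorem exs_embedding {α : Type*} {k : ℕ} {M N : Type (max u v)} [L.Structure M] [L.Structure N]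
    (e : M ↪[L] N) (φ : L.BoundedFormula α k) (hφ : φ.IsQF) (v : α → M)
    (h : φ.exs.Realize v) : φ.exs.Realize (fun a => e (v a)) := by
  rw [BoundedFormula.realize_exs] at h ⊢
  obtain ⟨xs, h⟩ := h
  exact ⟨e ∘ xs, (hφ.realize_embedding e).2 h⟩

/-- In empty structures, a sentence depends on finitely many nullary relations. -/
theorem empty_sentence (M : Type (max u v)) [L.Structure M] [IsEmpty M] :
    ∀ {n : ℕ} (ψ : L.BoundedFormula Empty n), n = 0 →
    ∃ Δ ⊆ qfDiag L M, Δ.Finite ∧ ∀ (N : BStruc L) (w : M → N.carrier), IsEmpty N.carrier →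
      (∀ φ ∈ Δ, φ.Realize w) → ∀ (xs : Fin n → N.carrier) (ys : Fin n → M),
        (ψ.Realize default xs ↔ ψ.Realize default ys) := by
  intro n ψ
  induction ψ with
  | falsum => exact fun _ => ⟨∅, by simp, by simp, fun _ _ _ _ _ _ => Iff.rfl⟩
  | equal t₁ t₂ =>
    exact fun _ => ⟨∅, by simp, by simp, fun _ _ _ _ _ ys => isEmptyElim (t₁.realize (Sum.elim default ys))⟩
  | @rel m l R ts =>
    rintro rfl
    rcases Nat.eq_zero_or_pos l with rfl | hl
    · let ρ : L.Formula M := R.formula fun i => i.elim0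
      have hρ : ρ.IsQF := (BoundedFormula.IsAtomic.rel _ _).isQF
      have aux : ∀ (N : BStruc L) (w : M → N.carrier) (xs : Fin 0 → N.carrier),
          (ρ.Realize w ↔ (BoundedFormula.rel R ts).Realize default xs) := by
        intro N w xs
        simp only [ρ, Formula.realize_rel, BoundedFormula.realize_rel, BoundedFormula.Realize]
        apply iff_of_eq
        congr 1
        exact Subsingleton.elim _ _
      by_cases hr : ρ.Realize (id : M → M)
      · refine ⟨{ρ}, by simpa [qfDiag] using ⟨hρ, hr⟩, by simp, fun N w _ h xs ys => ?_⟩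
        have h1 := (aux N w xs).1 (h ρ rfl)
        have h2 := (aux ⟨M, inferInstance⟩ id ys).1 hr
        exact iff_of_true h1 h2
      · refine ⟨{ρ.not}, ?_, by simp, fun N w _ h xs ys => ?_⟩
        · simpa [qfDiag] using ⟨hρ.not, hr⟩
        have h1 := fun hh => Formula.realize_not.1 (h ρ.not rfl) ((aux N w xs).2 hh)
        have h2 := fun hh => hr ((aux ⟨M, inferInstance⟩ id ys).2 hh)
        exact iff_of_false h1 h2
    · exact ⟨∅, by simp, by simp, fun _ _ _ _ _ ys =>
        isEmptyElim ((ts ⟨0, hl⟩).realize (Sum.elim default ys))⟩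
  | imp φ₁ φ₂ ih₁ ih₂ =>
    intro hn
    obtain ⟨Δ₁, h1, h2, h3⟩ := ih₁ hn
    obtain ⟨Δ₂, k1, k2, k3⟩ := ih₂ hn
    refine ⟨Δ₁ ∪ Δ₂, Set.union_subset h1 k1, h2.union k2, fun N w hN h xs ys => ?_⟩
    rw [BoundedFormula.realize_imp, BoundedFormula.realize_imp,
      h3 N w hN (fun φ hφ => h φ (Or.inl hφ)) xs ys, k3 N w hN (fun φ hφ => h φ (Or.inr hφ)) xs ys]
  | all φ ih =>
    intro _
    refine ⟨∅, by simp, by simp, fun N _ hN _ xs ys => ?_⟩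
    rw [BoundedFormula.realize_all, BoundedFormula.realize_all]
    exact iff_of_true (fun a => isEmptyElim a) (fun a => isEmptyElim a)

theorem exists_model_embedding (T : L.Theory) (M : Type (max u v)) [L.Structure M]
    (hM : M ⊨ univFrag T) : ∃ (N : BStruc L) (_ : M ↪[L] N.carrier), N.carrier ⊨ T := by
  by_cases hsat : SatN T (qfDiag L M)
  · obtain ⟨N, w, _, hT, hw⟩ := hsat
    obtain ⟨e, _⟩ := exists_embedding w hw
    exact ⟨N, e, hT⟩
  · have hnot : ∃ Δ ⊆ qfDiag L M, Δ.Finite ∧ ¬ SatN T Δ := by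
      by_contra hc
      push Not at hc
      exact hsat (satN_compact T _ hc)
    obtain ⟨Δ, hΔ, hf, hns⟩ := hnot
    rcases isEmpty_or_nonempty M with hE | hne
    · refine ⟨⟨M, inferInstance⟩, Embedding.refl L M, ?_⟩
      show M ⊨ T
      rw [Theory.model_iff]
      intro ψ hψ
      obtain ⟨Δ', k1, k2, k3⟩ := empty_sentence M ψ rfl
      obtain ⟨N, w, hNT, hw⟩ := finite_diag T M hM (Δ ∪ Δ') (hf.union k2) (Set.union_subset hΔ k1)
      have hNe : IsEmpty N.carrier := by
        by_contra h
        rw [not_isEmpty_iff] at h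
        exact hns ⟨N, w, h, hNT, fun φ hφ => hw φ (Or.inl hφ)⟩
      exact (k3 N w hNe (fun φ hφ => hw φ (Or.inr hφ)) default default).1
        (Theory.realize_sentence_of_mem T hψ)
    · obtain ⟨N, w, hNT, hw⟩ := finite_diag T M hM Δ hf hΔ
      exact absurd ⟨N, w, hne.map w, hNT, hw⟩ hns

/-- Formulas preserved upwards by embeddings. -/
def Upward (L : FirstOrder.Language.{u, v}) (α : Type (max u v)) : Set (L.Formula α) :=
  {ψ | ∀ (A B : BStruc L) (f : A.carrier ↪[L] B.carrier) (v : α → A.carrier),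
    ψ.Realize v → ψ.Realize fun a => f (v a)}

theorem step (T : L.Theory) (M : BStruc L) (hne : Nonempty M.carrier)
    (hM : M.carrier ⊨ univFrag T) :
    ∃ (M' : BStruc L) (e : M.carrier ↪[L] M'.carrier), M'.carrier ⊨ T ∧
      ∀ (N : BStruc L) (f : M'.carrier ↪[L] N.carrier), N.carrier ⊨ T →
        ∀ ψ ∈ Upward L M.carrier, ψ.Realize (fun a => f (e a)) → ψ.Realize e := by
  let F : Set (Set (L.Formula M.carrier)) := {Γ | Γ ⊆ Upward L M.carrier ∧ SatN T Γ}
  have hF : Order.IsOfFiniteCharacter F := by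
    intro Γ
    refine ⟨fun h Δ hΔ _ => ⟨hΔ.trans h.1, h.2.mono hΔ⟩, fun h => ⟨fun φ hφ => ?_, ?_⟩⟩
    · exact (h {φ} (by simpa using hφ) (by simp)).1 rfl
    · exact satN_compact T Γ fun Δ hΔ hf => (h Δ hΔ hf).2
  have hD : qfDiag L M.carrier ∈ F := by
    refine ⟨fun φ hφ A B f v h => (qf_formula_embedding f φ hφ.1 v).2 h, ?_⟩
    obtain ⟨N, e, hN⟩ := exists_model_embedding T M.carrier hM
    exact ⟨N, e, hne.map e, hN, fun φ hφ => (qf_formula_embedding e φ hφ.1 id).2 hφ.2⟩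
  obtain ⟨Γ, hΓ, hDΓ⟩ : ∃ Γ, Maximal (· ∈ F) Γ ∧ qfDiag L M.carrier ⊆ Γ := by
    obtain ⟨Γ, h1, h2⟩ := hF.exists_maximal hD
    exact ⟨Γ, by assumption, by assumption⟩
  obtain ⟨hup, M', w, hne', hT', hw⟩ := hΓ.prop
  obtain ⟨e, he⟩ := exists_embedding w fun φ hφ => hw φ (hDΓ hφ)
  have hew : (e : M.carrier → M'.carrier) = w := funext he
  refine ⟨M', e, hT', fun N f hN ψ hψ hr => ?_⟩
  rw [hew] at hr ⊢
  apply hw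
  have hmem : insert ψ Γ ∈ F := by
    refine ⟨Set.insert_subset hψ hup, N, fun a => f (w a), hne'.map f, hN, ?_⟩
    rintro φ (rfl | hφ)
    · exact hr
    · exact hup hφ M' N f w (hw φ hφ)
  exact hΓ.le_of_ge hmem (Set.subset_insert _ _) (Set.mem_insert _ _)

theorem model_univFrag (T : L.Theory) (N : BStruc L) (hN : N.carrier ⊨ T) :
    N.carrier ⊨ univFrag T := by
  rw [Theory.model_iff]
  exact fun ψ hψ => hψ.2 N hN

/-- The nonempty case. -/
theorem exists_ec_nonempty (T : L.Theory) (M : BStruc L) (hne : Nonempty M.carrier)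
    (hM : M.carrier ⊨ univFrag T) :
    ∃ (N : BStruc L) (_ : M.carrier ↪[L] N.carrier), IsEC T N.carrier := by
  let K := {A : BStruc L // Nonempty A.carrier ∧ A.carrier ⊨ univFrag T}
  have hstep : ∀ A : K, ∃ (B : K) (e : A.1.carrier ↪[L] B.1.carrier),
      ∀ (N : BStruc L) (f : B.1.carrier ↪[L] N.carrier), N.carrier ⊨ T →
        ∀ ψ ∈ Upward L A.1.carrier, ψ.Realize (fun a => f (e a)) → ψ.Realize e := by
    intro A
    obtain ⟨B, e, hB, h⟩ := step T A.1 A.2.1 A.2.2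
    exact ⟨⟨B, A.2.1.map e, model_univFrag T B hB⟩, e, h⟩
  choose nx e he using hstep
  let S : ℕ → K := fun n => Nat.rec ⟨M, hne, hM⟩ (fun _ A => nx A) n
  let G : ℕ → Type (max u v) := fun n => (S n).1.carrier
  let f' : ∀ n, G n ↪[L] G (n + 1) := fun n => e (S n)
  let f := DirectedSystem.natLERec f'
  let D : Type (max u v) := Language.DirectLimit G f
  let o : ∀ n, G n ↪[L] D := fun n => Language.DirectLimit.of L ℕ G f n
  have ho : ∀ n (x : G n), o (n + 1) (f' n x) = o n x := by
    intro n x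
    have h1 := Language.DirectLimit.of_f (L := L) (ι := ℕ) (G := G) (f := f) (hij := Nat.le_succ n) (x := x)
    have h2 : f n (n + 1) (Nat.le_succ n) x = f' n x := by
      simp [f, Nat.leRecOn_succ']
    rw [← h1]
    exact congrArg _ h2.symm
  have hfin : ∀ {k : ℕ} (x : Fin k → D), ∃ (i : ℕ) (y : Fin k → G i), x = fun a => o i (y a) :=
    fun x => Language.DirectLimit.exists_quotient_mk'_sigma_mk'_eq G f x
  have hD : D ⊨ univFrag T := by
    rw [Theory.model_iff]
    rintro ψ ⟨⟨n, φ, hφ, rfl⟩, hc⟩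
    simp only [Sentence.Realize, BoundedFormula.realize_alls]
    intro xs
    obtain ⟨i, y, rfl⟩ := hfin xs
    have h1 : G i ⊨ φ.alls :=
      @Theory.realize_sentence_of_mem _ _ _ (univFrag T) (S i).2.2 _ ⟨⟨n, φ, hφ, rfl⟩, hc⟩
    simp only [Sentence.Realize, BoundedFormula.realize_alls] at h1
    have h2 := (hφ.realize_embedding (o i)).2 (h1 y)
    rw [Subsingleton.elim ((o i) ∘ default) default] at h2
    exact h2
  refine ⟨⟨D, inferInstance⟩, o 0, exists_model_embedding T D hD, ?_⟩
  intro N g hN n k φ hφ v hr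
  obtain ⟨i, y, rfl⟩ := hfin v
  have hup : φ.exs.relabel y ∈ Upward L (S i).1.carrier := by
    intro A B h v hv
    rw [Formula.realize_relabel] at hv ⊢
    exact exs_embedding h φ hφ _ hv
  have h1 := he (S i) N (g.comp (o (i + 1))) hN (φ.exs.relabel y) hup (by
    rw [Formula.realize_relabel]
    convert hr using 1
    funext a
    exact congrArg g (ho i (y a)))
  rw [Formula.realize_relabel] at h1
  have h2 := exs_embedding (o (i + 1)) φ hφ _ h1
  convert h2 using 1
  funext a
  exact (ho i (y a)).symm

/-- every model of `T_∀` embeds into a `T`-existentially closed structure. -/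
theorem exists_ec_extension (T : L.Theory) (hT : Consistent T)
    (M : Type (max u v)) [L.Structure M] (hM : M ⊨ univFrag T) :
    ∃ (N : BStruc L) (_ : M ↪[L] N.carrier), IsEC T N.carrier := by
  by_cases h : ∃ (N : BStruc L) (_ : M ↪[L] N.carrier), N.carrier ⊨ T ∧ Nonempty N.carrier
  · obtain ⟨N, e, hN, hne⟩ := h
    obtain ⟨N', e', h'⟩ := exists_ec_nonempty T N hne (model_univFrag T N hN)
    exact ⟨N', e'.comp e, h'⟩
  · refine ⟨⟨M, inferInstance⟩, Embedding.refl L M, exists_model_embedding T M hM, ?_⟩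
    intro N e hN n k φ hφ v hr
    have hE : IsEmpty N.carrier := by
      by_contra hc
      exact h ⟨N, e, hN, not_isEmpty_iff.1 hc⟩
    rw [BoundedFormula.realize_exs] at hr ⊢
    obtain ⟨xs, hx⟩ := hr
    refine ⟨fun i => isEmptyElim (xs i), ?_⟩
    rw [← hφ.realize_embedding e]
    convert hx using 1

end ModelCompanionship
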